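/- arXiv:1506.04047 — 2 statements merged into one kernel-verified Lean document; each statement's English description precedes it below -/
import Mathlib

section
/- (Price of anarchy of the CSR game is at most 3.) Let G be a finite connected simple graph on a vertex set V of n players and let O be a finite set of resources with 2 ≤ |O| < n. If P* is a pure Nash equilibrium of the CSR game on G, then for every allocation Q (in particular for every optimal allocation), C(P*) ≤ 3·C(Q). -/
open Finset

noncomputable section

variable {V O : Type*} [Fintype V] [DecidableEq V] [Fintype O] [DecidableEq O]

/-- Diameter of the graph: maximum graph distance between any two vertices. -/
def csrDiam (G : SimpleGraph V) : ℕ :=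
  Finset.sup Finset.univ fun i => Finset.sup Finset.univ fun j => G.dist i j

/-- Distance from player `i` to the nearest holder of resource `o` under allocation `P`;
`csrDiam G + 1` if no one holds `o`. -/
def csrDist (G : SimpleGraph V) (P : V → O) (i : V) (o : O) : ℕ :=
  if h : (Finset.univ.filter fun j => P j = o).Nonempty then
    (Finset.univ.filter fun j => P j = o).inf' h fun j => G.dist i j
  else csrDiam G + 1

/-- Cost of player `i` under allocation `P`. -/
def csrCost (G : SimpleGraph V) (P : V → O) (i : V) : ℕ :=
  ∑ o ∈ Finset.univ.filter (fun o => o ≠ P i), csrDist G P i o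

/-- Total cost of allocation `P`. -/
def csrTotal (G : SimpleGraph V) (P : V → O) : ℕ := ∑ i, csrCost G P i

/-- Radius of player `i`: distance to nearest *other* player holding the same resource;
`csrDiam G` if there is none. -/
def csrRadius (G : SimpleGraph V) (P : V → O) (i : V) : ℕ :=
  if h : (Finset.univ.filter fun j => j ≠ i ∧ P j = P i).Nonempty then
    (Finset.univ.filter fun j => j ≠ i ∧ P j = P i).inf' h fun j => G.dist i j
  else csrDiam G

/-- Ball of radius `r` (a natural number) around `i`. -/
def csrBall (G : SimpleGraph V) (i : V) (r : ℕ) : Finset V :=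
  Finset.univ.filter fun j => G.dist i j ≤ r

/-- Pure Nash equilibrium of the CSR game. -/
def csrIsNE (G : SimpleGraph V) (P : V → O) : Prop :=
  ∀ (i : V) (o : O), csrCost G P i ≤ csrCost G (Function.update P i o) i

theorem aux_dist_le (G : SimpleGraph V) (P : V → O) (i j : V) (o : O) (h : P j = o) :
    csrDist G P i o ≤ G.dist i j := by
  have hj : j ∈ Finset.univ.filter fun j => P j = o := by simp [h]
  unfold csrDist
  rw [dif_pos ⟨j, hj⟩]
  exact Finset.inf'_le _ hj

theorem aux_cases (G : SimpleGraph V) (P : V → O) (i : V) (o : O) :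
    (∃ j, P j = o ∧ csrDist G P i o = G.dist i j) ∨
      ((∀ j, P j ≠ o) ∧ csrDist G P i o = csrDiam G + 1) := by
  by_cases h : (Finset.univ.filter fun j => P j = o).Nonempty
  · left
    obtain ⟨j, hj, he⟩ := Finset.exists_mem_eq_inf' h (fun j => G.dist i j)
    refine ⟨j, by simpa using hj, ?_⟩
    unfold csrDist
    rw [dif_pos h, he]
  · right
    refine ⟨fun j hj => h ⟨j, by simp [hj]⟩, ?_⟩
    unfold csrDist
    rw [dif_neg h]

theorem aux_diam (G : SimpleGraph V) (i j : V) : G.dist i j ≤ csrDiam G := by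
  unfold csrDiam
  exact (Finset.le_sup (f := fun j => G.dist i j) (Finset.mem_univ j)).trans
    (Finset.le_sup (f := fun i => Finset.sup Finset.univ fun j => G.dist i j)
      (Finset.mem_univ i))

theorem aux_self (G : SimpleGraph V) (P : V → O) (i : V) : csrDist G P i (P i) = 0 := by
  have := aux_dist_le G P i i _ rfl
  simpa using this

theorem aux_cost (G : SimpleGraph V) (P : V → O) (i : V) :
    csrCost G P i = ∑ o, csrDist G P i o := by
  unfold csrCost
  apply Finset.sum_subset (Finset.filter_subset _ _)
  intro o _ ho
  have : o = P i := by simpa using ho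
  rw [this, aux_self]

theorem aux_tri (G : SimpleGraph V) (hconn : G.Connected) (P : V → O) (i j : V) (o : O) :
    csrDist G P i o ≤ G.dist i j + csrDist G P j o := by
  rcases aux_cases G P j o with ⟨x, hx, he⟩ | ⟨hn, he⟩
  · rw [he]
    exact (aux_dist_le G P i x o hx).trans hconn.dist_triangle
  · rcases aux_cases G P i o with ⟨x, hx, _⟩ | ⟨_, he'⟩
    · exact absurd hx (hn x)
    · omega

theorem aux_ne (G : SimpleGraph V) (P : V → O) (hNE : csrIsNE G P)
    (j j' : V) (hjj : j' ≠ j) (hP : P j' = P j) (o : O) :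
    csrDist G P j o ≤ G.dist j j' := by
  by_cases ho : o = P j
  · rw [ho, aux_self]; exact Nat.zero_le _
  have h := hNE j o
  rw [aux_cost, aux_cost] at h
  have h1 : ∑ o', csrDist G (Function.update P j o) j o' + csrDist G P j o ≤
      ∑ o', csrDist G P j o' + G.dist j j' := by
    have e1 : csrDist G P j o = ∑ o', if o' = o then csrDist G P j o else 0 := by simp
    have e2 : G.dist j j' = ∑ o', if o' = P j then G.dist j j' else 0 := by simp
    rw [e1, e2, ← Finset.sum_add_distrib, ← Finset.sum_add_distrib]
    apply Finset.sum_le_sum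
    intro o' _
    by_cases h1 : o' = o
    · subst h1
      have := aux_self G (Function.update P j o') j
      rw [Function.update_self] at this
      simp [this]
    · by_cases h2 : o' = P j
      · have := aux_dist_le G (Function.update P j o) j j' o'
          (by rw [Function.update_of_ne hjj, hP, h2])
        rw [if_neg h1, if_pos h2]; omega
      · rw [if_neg h1, if_neg h2]
        rcases aux_cases G P j o' with ⟨x, hx, he⟩ | ⟨hn, he⟩
        · have hxj : x ≠ j := by rintro rfl; exact h2 hx.symm
          have := aux_dist_le G (Function.update P j o) j x o'
            (by rw [Function.update_of_ne hxj, hx])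
          omega
        · rcases aux_cases G (Function.update P j o) j o' with ⟨x, _, he'⟩ | ⟨_, he'⟩
          · have := aux_diam G j x
            omega
          · omega
  omega

theorem aux_min (d t : ℕ) : min d t = ∑ s ∈ Finset.range t, if s < d then 1 else 0 := by
  rw [← Finset.sum_filter, Finset.sum_const, smul_eq_mul, mul_one]
  have : (Finset.range t).filter (fun s => s < d) = Finset.range (min d t) := by
    ext s; simp; omega
  rw [this, Finset.card_range]

theorem aux_main (G : SimpleGraph V) (hconn : G.Connected)
    (hOn : Fintype.card O < Fintype.card V)
    (P : V → O) (hNE : csrIsNE G P) (Q : V → O) (i : V) :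
    csrCost G P i ≤ 3 * csrCost G Q i := by
  have hex : ∃ t, ∃ j j', G.dist i j ≤ t ∧ G.dist i j' ≤ t ∧ j' ≠ j ∧ P j' = P j := by
    obtain ⟨j, j', hne, he⟩ := Fintype.exists_ne_map_eq_of_card_lt P hOn
    exact ⟨csrDiam G, j, j', aux_diam _ _ _, aux_diam _ _ _, hne.symm, he.symm⟩
  classical
  obtain ⟨t, ht, hmin⟩ : ∃ t, (∃ j j', G.dist i j ≤ t ∧ G.dist i j' ≤ t ∧ j' ≠ j ∧ P j' = P j) ∧
      ∀ s < t, ¬ ∃ j j', G.dist i j ≤ s ∧ G.dist i j' ≤ s ∧ j' ≠ j ∧ P j' = P j :=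
    ⟨Nat.find hex, Nat.find_spec hex, fun s hs => Nat.find_min hex hs⟩
  obtain ⟨j, j', hj, hj', hne, he⟩ := ht
  have htD : t ≤ csrDiam G := by
    by_contra hlt
    exact hmin (csrDiam G) (by omega)
      ⟨j, j', aux_diam _ _ _, aux_diam _ _ _, hne, he⟩
  have h3 : ∀ o, csrDist G P i o ≤ 3 * t := by
    intro o
    have a := aux_tri G hconn P i j o
    have b := aux_ne G P hNE j j' hne he o
    have c : G.dist j j' ≤ G.dist j i + G.dist i j' := hconn.dist_triangle
    rw [G.dist_comm (u := j) (v := i)] at c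
    omega
  have hsum : ∑ o, min (csrDist G P i o) t ≤ ∑ o, min (csrDist G Q i o) t := by
    simp_rw [aux_min]
    rw [Finset.sum_comm, Finset.sum_comm (s := Finset.univ) (t := Finset.range t)]
    apply Finset.sum_le_sum
    intro s hs
    rw [Finset.mem_range] at hs
    rw [← Finset.sum_filter, ← Finset.sum_filter]
    simp only [Finset.sum_const, smul_eq_mul, mul_one]
    have hP : (csrBall G i s).card ≤ (Finset.univ.filter fun o => ¬ s < csrDist G P i o).card := by
      apply Finset.card_le_card_of_injOn P
      · intro x hx
        have hx' : G.dist i x ≤ s := by simpa [csrBall] using hx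
        have := aux_dist_le G P i x _ rfl
        simp only [Finset.coe_filter, Finset.mem_univ, true_and, Set.mem_setOf_eq]
        omega
      · intro x hx y hy hxy
        by_contra hn
        exact hmin s hs ⟨x, y, by simpa [csrBall] using hx, by simpa [csrBall] using hy,
          fun h => hn h.symm, hxy.symm⟩
    have hQ : (Finset.univ.filter fun o => ¬ s < csrDist G Q i o).card ≤ (csrBall G i s).card := by
      refine le_trans (Finset.card_le_card ?_) (Finset.card_image_le (f := Q))
      intro o ho
      simp only [Finset.mem_filter, Finset.mem_univ, true_and] at ho
      rcases aux_cases G Q i o with ⟨x, hx, he⟩ | ⟨_, he⟩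
      · refine Finset.mem_image.mpr ⟨x, ?_, hx⟩
        simp only [csrBall, Finset.mem_filter, Finset.mem_univ, true_and]
        omega
      · omega
    have e1 := Finset.card_filter_add_card_filter_not (s := (Finset.univ : Finset O))
      (fun o => s < csrDist G P i o)
    have e2 := Finset.card_filter_add_card_filter_not (s := (Finset.univ : Finset O))
      (fun o => s < csrDist G Q i o)
    omega
  rw [aux_cost, aux_cost]
  calc ∑ o, csrDist G P i o ≤ ∑ o, 3 * min (csrDist G P i o) t := by
        apply Finset.sum_le_sum
        intro o _
        have := h3 o
        omega
    _ = 3 * ∑ o, min (csrDist G P i o) t := by rw [Finset.mul_sum]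
    _ ≤ 3 * ∑ o, min (csrDist G Q i o) t := Nat.mul_le_mul_left _ hsum
    _ ≤ 3 * ∑ o, csrDist G Q i o :=
        Nat.mul_le_mul_left _ (Finset.sum_le_sum fun o _ => min_le_left _ _)

/-- The price of anarchy of the CSR game is at most 3: the total cost of any
pure Nash equilibrium is at most three times the total cost of any allocation. -/
theorem stmt5 (G : SimpleGraph V) (hconn : G.Connected)
    (hO2 : 2 ≤ Fintype.card O) (hOn : Fintype.card O < Fintype.card V)
    (Pstar : V → O) (hNE : csrIsNE G Pstar) :
    ∀ Q : V → O, csrTotal G Pstar ≤ 3 * csrTotal G Q := by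
  intro Q
  unfold csrTotal
  rw [Finset.mul_sum]
  exact Finset.sum_le_sum fun i _ => aux_main G hconn hOn Pstar hNE Q i
end
end

section
/- (Potential decrease under an ε-improving update.) Let G be a finite connected simple graph on a vertex set V of n ≥ 2 players, let O be a finite set of resources, let ε > 1 be real, and set L = log n / log ε. Suppose allocations P and P' agree on every player except player i, and that r_i(P') ≥ ε·r_i(P), and that |{k ∈ V : r_k(P) ≥ r_i(P')}| ≤ n − 2. Then Σ_{k∈V} r_k(P')^{−L} ≤ Σ_{k∈V} r_k(P)^{−L} − 1/(n·r_i(P)^{L}). -/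
open Finset

noncomputable section

variable {V O : Type*} [Fintype V] [DecidableEq V] [Fintype O] [DecidableEq O]

theorem aux_dist_le_diam (G : SimpleGraph V) (a b : V) : G.dist a b ≤ csrDiam G := by
  unfold csrDiam
  exact le_trans (Finset.le_sup (f := fun j => G.dist a j) (Finset.mem_univ b))
    (Finset.le_sup (f := fun a => Finset.sup Finset.univ fun j => G.dist a j) (Finset.mem_univ a))

theorem aux_radius_le_diam (G : SimpleGraph V) (P : V → O) (k : V) :
    csrRadius G P k ≤ csrDiam G := by
  unfold csrRadius
  split_ifs with h
  · obtain ⟨j, hj⟩ := h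
    exact le_trans (Finset.inf'_le _ hj) (aux_dist_le_diam G k j)
  · exact le_rfl

theorem aux_radius_le (G : SimpleGraph V) (P : V → O) (k j : V) (hj : j ≠ k) (h : P j = P k) :
    csrRadius G P k ≤ G.dist k j := by
  have hm : j ∈ Finset.univ.filter fun j => j ≠ k ∧ P j = P k := by simp [hj, h]
  unfold csrRadius
  rw [dif_pos ⟨j, hm⟩]
  exact Finset.inf'_le _ hm

theorem aux_le_radius (G : SimpleGraph V) (P : V → O) (k : V) (m : ℕ) (hm : m ≤ csrDiam G)
    (h : ∀ j, j ≠ k → P j = P k → m ≤ G.dist k j) : m ≤ csrRadius G P k := by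
  unfold csrRadius
  split_ifs with hh
  · refine Finset.le_inf' _ _ ?_
    intro j hj
    simp only [Finset.mem_filter, Finset.mem_univ, true_and] at hj
    exact h j hj.1 hj.2
  · exact hm

theorem aux_radius_pos (G : SimpleGraph V) (hconn : G.Connected) (hn : 2 ≤ Fintype.card V)
    (P : V → O) (k : V) : 1 ≤ csrRadius G P k := by
  apply aux_le_radius
  · have : Nontrivial V := Fintype.one_lt_card_iff_nontrivial.mp (by omega)
    obtain ⟨j, hj⟩ := exists_ne k
    exact le_trans (hconn.pos_dist_of_ne hj) (aux_dist_le_diam G j k)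
  · intro j hj _
    exact hconn.pos_dist_of_ne hj.symm

theorem aux_min_s11 (G : SimpleGraph V) (P P' : V → O) (i k : V) (hk : k ≠ i)
    (hagree : ∀ k : V, k ≠ i → P' k = P k) :
    min (csrRadius G P k) (csrRadius G P' i) ≤ csrRadius G P' k := by
  apply aux_le_radius
  · exact le_trans (min_le_left _ _) (aux_radius_le_diam G P k)
  · intro j hj h
    by_cases hji : j = i
    · subst hji
      rw [SimpleGraph.dist_comm]
      exact le_trans (min_le_right _ _) (aux_radius_le G P' j k hk h.symm)
    · rw [hagree j hji, hagree k hk] at h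
      exact le_trans (min_le_left _ _) (aux_radius_le G P k j hj h)

/-- Potential decrease under an ε-improving update. With
`L = log n / log ε`, if player `i` unilaterally updates so that her radius grows by a
factor of at least `ε`, and at most `n - 2` players `k` have `r_k(P) ≥ r_i(P')`, then
the potential `Σ_k r_k^{-L}` decreases by at least `1/(n · r_i(P)^L)`. -/
theorem stmt11 (G : SimpleGraph V) (hconn : G.Connected)
    (hn : 2 ≤ Fintype.card V) (ε : ℝ) (hε : 1 < ε)
    (P P' : V → O) (i : V)
    (hagree : ∀ k : V, k ≠ i → P' k = P k)
    (himp : ε * (csrRadius G P i : ℝ) ≤ (csrRadius G P' i : ℝ))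
    (hfew : (Finset.univ.filter fun k : V =>
        csrRadius G P' i ≤ csrRadius G P k).card ≤ Fintype.card V - 2) :
    ∑ k : V, (csrRadius G P' k : ℝ) ^
        (-(Real.log (Fintype.card V) / Real.log ε)) ≤
      (∑ k : V, (csrRadius G P k : ℝ) ^
          (-(Real.log (Fintype.card V) / Real.log ε)))
        - 1 / ((Fintype.card V : ℝ) *
            (csrRadius G P i : ℝ) ^ (Real.log (Fintype.card V) / Real.log ε)) := by
  classical
  set n : ℕ := Fintype.card V with hndef
  set L : ℝ := Real.log n / Real.log ε with hL
  have hn1 : (1 : ℝ) < n := by exact_mod_cast (by omega : 1 < n)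
  have hlε : 0 < Real.log ε := Real.log_pos hε
  have hLpos : 0 < L := div_pos (Real.log_pos hn1) hlε
  have hεL : ε ^ L = n := by
    rw [Real.rpow_def_of_pos (by linarith), hL, mul_div_cancel₀ _ hlε.ne',
      Real.exp_log (by linarith)]
  have pos : ∀ (Q : V → O) k, (0 : ℝ) < csrRadius G Q k := fun Q k => by
    exact_mod_cast aux_radius_pos G hconn hn Q k
  have anti : ∀ a b : ℝ, 0 < a → a ≤ b → b ^ (-L) ≤ a ^ (-L) := fun a b ha hab =>
    Real.rpow_le_rpow_of_nonpos ha hab (by linarith)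
  set r : ℝ := ((csrRadius G P i : ℕ) : ℝ) with hr
  set R : ℝ := ((csrRadius G P' i : ℕ) : ℝ) with hR
  have hr0 : 0 < r := pos P i
  have hfR : R ^ (-L) ≤ r ^ (-L) / n := by
    refine (anti (ε * r) R (by positivity) himp).trans (le_of_eq ?_)
    rw [Real.mul_rpow (by linarith) hr0.le, Real.rpow_neg (by linarith : (0 : ℝ) ≤ ε), hεL]
    ring
  have hfR0 : 0 ≤ R ^ (-L) := (Real.rpow_pos_of_pos (pos P' i) _).le
  have key : ∀ k, (csrRadius G P' k : ℝ) ^ (-L) ≤ (csrRadius G P k : ℝ) ^ (-L)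
      + (if csrRadius G P' i ≤ csrRadius G P k then R ^ (-L) else 0)
      + (if k = i then R ^ (-L) - r ^ (-L) else 0) := by
    intro k
    by_cases hk : k = i
    · subst hk
      rw [if_pos rfl]
      split_ifs <;> linarith
    · rw [if_neg hk]
      have h := aux_min_s11 G P P' i k hk hagree
      split_ifs with hB
      · rw [min_eq_right hB] at h
        have h1 := anti R (csrRadius G P' k) (pos P' i) (Nat.cast_le.mpr h)
        have h2 : 0 < (csrRadius G P k : ℝ) ^ (-L) := Real.rpow_pos_of_pos (pos P k) _
        linarith
      · rw [min_eq_left (by omega)] at h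
        have h1 := anti (csrRadius G P k) (csrRadius G P' k) (pos P k) (by exact_mod_cast h)
        linarith
  have hsum := Finset.sum_le_sum (s := Finset.univ) fun k _ => key k
  rw [Finset.sum_add_distrib, Finset.sum_add_distrib, Finset.sum_ite_eq' Finset.univ i,
    if_pos (Finset.mem_univ i), ← Finset.sum_filter, Finset.sum_const, nsmul_eq_mul] at hsum
  have hc : ((Finset.univ.filter fun k : V =>
      csrRadius G P' i ≤ csrRadius G P k).card : ℝ) ≤ n - 2 := by
    have : (Finset.univ.filter fun k : V =>
      csrRadius G P' i ≤ csrRadius G P k).card + 2 ≤ n := by omega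
    have h2 : (((Finset.univ.filter fun k : V =>
      csrRadius G P' i ≤ csrRadius G P k).card + 2 : ℕ) : ℝ) ≤ n := by exact_mod_cast this
    push_cast at h2
    linarith
  have h3 := mul_le_mul_of_nonneg_right hc hfR0
  have h4 := mul_le_mul_of_nonneg_left hfR (by linarith : (0 : ℝ) ≤ n - 1)
  have h5 : 1 / ((n : ℝ) * r ^ L) = r ^ (-L) / n := by
    rw [Real.rpow_neg hr0.le]
    field_simp
  have h6 : ((n : ℝ) - 1) * (r ^ (-L) / n) = r ^ (-L) - r ^ (-L) / n := by
    field_simp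
  rw [h5]
  linarith
end
end
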